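/- arXiv:1712.08358 — 2 statements merged into one kernel-verified Lean document; each statement's English description precedes it below -/
import Mathlib

section
/- Let q ≥ 1, α ∈ ℝ, n ∈ ℕ₀, and (s_j)_{j=0}^{2n+1} ∈ K≥,e_{α,q,2n+1}. Let G := H_n^⊐ and G_α := H_{α▷n}^⊐. Then G and G_α are positive semidefinite (in particular G* = G and G_α* = G_α), the equations H_n·G·H_n = H_n, G·H_n·G = G, H_{α▷n}·G_α·H_{α▷n} = H_{α▷n}, G_α·H_{α▷n}·G_α = G_α hold, and moreover G·H_n·G_α = G_α and G_α·H_n·G = G_α. -/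
open Matrix ComplexConjugate
open scoped ComplexOrder

noncomputable section

/-- The block Hankel matrix `H_n = [s_{j+k}]_{j,k=0}^n`. -/
def hank (q n : ℕ) (s : ℕ → Matrix (Fin q) (Fin q) ℂ) :
    Matrix (Fin (n + 1) × Fin q) (Fin (n + 1) × Fin q) ℂ :=
  Matrix.of fun j k => s (j.1.val + k.1.val) j.2 k.2

/-- The right-sided `α`-shifted sequence `s_{α▷j} = -α·s_j + s_{j+1}`. -/
def sShift {q : ℕ} (α : ℝ) (s : ℕ → Matrix (Fin q) (Fin q) ℂ) :
    ℕ → Matrix (Fin q) (Fin q) ℂ :=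
  fun j => (-(α : ℂ)) • s j + s (j + 1)

/-- The block shift `T_{q,n} = [δ_{j,k+1}·I_q]_{j,k=0}^n`. -/
def bshift (q n : ℕ) : Matrix (Fin (n + 1) × Fin q) (Fin (n + 1) × Fin q) ℂ :=
  Matrix.of fun j k => if j.1.val = k.1.val + 1 ∧ j.2 = k.2 then (1 : ℂ) else 0

/-- `v_{q,n} = col(δ_{j,0}·I_q)_{j=0}^n`. -/
def vq (q n : ℕ) : Matrix (Fin (n + 1) × Fin q) (Fin q) ℂ :=
  Matrix.of fun j b => if j.1.val = 0 ∧ j.2 = b then (1 : ℂ) else 0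

/-- `u_n = -col(s_{j-1})_{j=0}^n` with `s_{-1} = 0`. -/
def uq (q n : ℕ) (s : ℕ → Matrix (Fin q) (Fin q) ℂ) :
    Matrix (Fin (n + 1) × Fin q) (Fin q) ℂ :=
  Matrix.of fun j b => if j.1.val = 0 then 0 else -s (j.1.val - 1) j.2 b

/-- `y_{0,n} = col(s_j)_{j=0}^n`. -/
def yq (q n : ℕ) (s : ℕ → Matrix (Fin q) (Fin q) ℂ) :
    Matrix (Fin (n + 1) × Fin q) (Fin q) ℂ :=
  Matrix.of fun j b => s j.1.val j.2 b

/-- `R_T(z) = (I - z·T_{q,n})⁻¹`. -/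
def RT (q n : ℕ) (z : ℂ) : Matrix (Fin (n + 1) × Fin q) (Fin (n + 1) × Fin q) ℂ :=
  (1 - z • bshift q n)⁻¹

/-- `R_{T*}(z) = (I - z·T_{q,n}*)⁻¹`. -/
def RTs (q n : ℕ) (z : ℂ) : Matrix (Fin (n + 1) × Fin q) (Fin (n + 1) × Fin q) ℂ :=
  (1 - z • (bshift q n)ᴴ)⁻¹

open scoped Classical in
/-- The Moore–Penrose inverse of a complex matrix (it exists and is unique,
so the `dite` below always takes its first branch and picks it out). -/
def mp {m n : Type*} [Fintype m] [Fintype n] (A : Matrix m n ℂ) : Matrix n m ℂ :=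
  if h : ∃ X : Matrix n m ℂ,
      A * X * A = A ∧ X * A * X = X ∧ (A * X)ᴴ = A * X ∧ (X * A)ᴴ = X * A
  then h.choose else 0

/-- The Schur complements `L_0 = s_0` and
`L_j = s_{2j} - z_{j,2j-1}·(H_{j-1})^†·y_{j,2j-1}` for `j ≥ 1`. -/
def LS (q : ℕ) (s : ℕ → Matrix (Fin q) (Fin q) ℂ) : ℕ → Matrix (Fin q) (Fin q) ℂ
  | 0 => s 0
  | n + 1 =>
      s (2 * (n + 1)) -
        (Matrix.of fun (a : Fin q) (j : Fin (n + 1) × Fin q) => s ((n + 1) + j.1.val) a j.2) *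
          mp (hank q n s) *
          (Matrix.of fun (j : Fin (n + 1) × Fin q) (b : Fin q) => s ((n + 1) + j.1.val) j.2 b)

/-- The block diagonal matrix `diag(L_0, …, L_n)`. -/
def Ldiag (q n : ℕ) (s : ℕ → Matrix (Fin q) (Fin q) ℂ) :
    Matrix (Fin (n + 1) × Fin q) (Fin (n + 1) × Fin q) ℂ :=
  Matrix.of fun j k => if j.1 = k.1 then LS q s j.1.val j.2 k.2 else 0

/-- The subspace `D_n = range(diag(L_0, …, L_n)) ⊆ ℂ^{(n+1)q}`. -/
def Dsub (q n : ℕ) (s : ℕ → Matrix (Fin q) (Fin q) ℂ) :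
    Submodule ℂ (Fin (n + 1) × Fin q → ℂ) :=
  LinearMap.range (Matrix.mulVecLin (Ldiag q n s))

/-- `V_{q,n+1} = [δ_{j,k}·I_q]`, embedding `ℂ^{(n+1)q}` into the first `n+1` block
components of `ℂ^{(n+2)q}` (defined here with `n+1` block columns). -/
def embV (q n : ℕ) : Matrix (Fin (n + 1) × Fin q) (Fin n × Fin q) ℂ :=
  Matrix.of fun j k => if j.1.val = k.1.val ∧ j.2 = k.2 then (1 : ℂ) else 0

/-- `𝔙_{q,n+1} = [δ_{j,k+1}·I_q]`, embedding `ℂ^{(n+1)q}` into the last `n+1` block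
components of `ℂ^{(n+2)q}` (defined here with `n+1` block columns). -/
def embW (q n : ℕ) : Matrix (Fin (n + 1) × Fin q) (Fin n × Fin q) ℂ :=
  Matrix.of fun j k => if j.1.val = k.1.val + 1 ∧ j.2 = k.2 then (1 : ℂ) else 0

end

/-- `G` is the generalized inverse `H_D^⊐` of a Hermitian matrix `H` associated with a
subspace `D`: `HGH = H`, `GHG = G`, `range G = D` and `ker G = D^⊥`. -/
def IsRGI {ι : Type*} [Fintype ι] (H G : Matrix ι ι ℂ) (D : Submodule ℂ (ι → ℂ)) : Prop :=
  H * G * H = H ∧ G * H * G = G ∧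
    LinearMap.range (Matrix.mulVecLin G) = D ∧
    ∀ x : ι → ℂ, Matrix.mulVec G x = 0 ↔ ∀ y ∈ D, dotProduct (star y) x = 0

theorem aux_mp_exists {ι : Type*} [Fintype ι] [DecidableEq ι] (A : Matrix ι ι ℂ)
    (hA : A.IsHermitian) : ∃ X : Matrix ι ι ℂ,
      A * X * A = A ∧ X * A * X = X ∧ (A * X)ᴴ = A * X ∧ (X * A)ᴴ = X * A := by
  classical
  obtain ⟨U, V, d, hVU, hUV, hVs, hAe⟩ : ∃ (U V : Matrix ι ι ℂ) (d : ι → ℝ),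
      V * U = 1 ∧ Uᴴ = V ∧ Vᴴ = U ∧ A = U * diagonal (fun i => (d i : ℂ)) * V := by
    refine ⟨hA.eigenvectorUnitary, (star hA.eigenvectorUnitary : _), hA.eigenvalues, ?_, ?_, ?_, ?_⟩
    · simp
    · simp [star_eq_conjTranspose]
    · simp [star_eq_conjTranspose]
    · have h := hA.spectral_theorem
      rw [Unitary.conjStarAlgAut_apply] at h
      exact h
  have key : ∀ a b : ι → ℂ, (U * diagonal a * V) * (U * diagonal b * V)
      = U * diagonal (fun i => a i * b i) * V := by
    intro a b
    calc (U * diagonal a * V) * (U * diagonal b * V)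
        = U * diagonal a * (V * U) * diagonal b * V := by simp only [Matrix.mul_assoc]
      _ = _ := by rw [hVU, Matrix.mul_one, Matrix.mul_assoc U, diagonal_mul_diagonal]
  have keyH : ∀ a : ι → ℂ, (U * diagonal a * V)ᴴ = U * diagonal (star a) * V := by
    intro a
    rw [conjTranspose_mul, conjTranspose_mul, hUV, hVs, diagonal_conjTranspose, Matrix.mul_assoc]
  refine ⟨U * diagonal (fun i => ((d i)⁻¹ : ℂ)) * V, ?_, ?_, ?_, ?_⟩
  · rw [hAe, key, key]
    congr 3
    ext i
    by_cases h : (d i : ℂ) = 0 <;> simp [h]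
  · rw [hAe, key, key]
    congr 3
    ext i
    by_cases h : (d i : ℂ) = 0 <;> simp [h]
  · rw [hAe, key, keyH]
    congr 3
    ext i
    simp
  · rw [hAe, key, keyH]
    congr 3
    ext i
    simp

theorem aux_mp_spec {ι : Type*} [Fintype ι] [DecidableEq ι] (A : Matrix ι ι ℂ)
    (hA : A.IsHermitian) :
      A * mp A * A = A ∧ mp A * A * mp A = mp A ∧ (A * mp A)ᴴ = A * mp A ∧
        (mp A * A)ᴴ = mp A * A := by
  have h := aux_mp_exists A hA
  unfold mp
  rw [dif_pos h]
  exact h.choose_spec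

theorem aux_perp {ι : Type*} [Fintype ι] (A : Matrix ι ι ℂ) (x : ι → ℂ) :
    (∀ y ∈ LinearMap.range (Matrix.mulVecLin A), dotProduct (star y) x = 0) ↔ Aᴴ *ᵥ x = 0 := by
  have e : ∀ w : ι → ℂ, star (A *ᵥ w) ⬝ᵥ x = star w ⬝ᵥ (Aᴴ *ᵥ x) := by
    intro w
    rw [star_mulVec, dotProduct_mulVec]
  constructor
  · intro h
    have h1 := h (A *ᵥ (Aᴴ *ᵥ x)) ⟨_, rfl⟩
    rw [e] at h1
    exact dotProduct_star_self_eq_zero.1 h1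
  · rintro h _ ⟨w, rfl⟩
    rw [mulVecLin_apply, e, h, dotProduct_zero]

/-- RGI of a PSD matrix. -/
theorem aux_rgi {ι : Type*} [Fintype ι] {H G : Matrix ι ι ℂ} {D : Submodule ℂ (ι → ℂ)}
    (hH : H.IsHermitian) (h : IsRGI H G D) : G = G * H * Gᴴ := by
  classical
  obtain ⟨h1, h2, h3, h4⟩ := h
  have : G * (1 - H * Gᴴ) = 0 := by
    apply Matrix.ext_of_mulVec_single
    intro i
    rw [zero_mulVec, ← mulVec_mulVec, h4, ← h3, aux_perp, mulVec_mulVec, Matrix.mul_sub,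
      Matrix.mul_one]
    have e : Gᴴ * (H * Gᴴ) = Gᴴ := by
      have := congrArg conjTranspose h2
      rwa [conjTranspose_mul, conjTranspose_mul, hH] at this
    rw [e, sub_self, zero_mulVec]
  rw [Matrix.mul_sub, Matrix.mul_one, ← Matrix.mul_assoc, sub_eq_zero] at this
  exact this

theorem aux_hank_mulVec (q m : ℕ) (s : ℕ → Matrix (Fin q) (Fin q) ℂ) (X : ℕ → Fin q → ℂ)
    (k : Fin (m + 1)) (a : Fin q) :
    (hank q m s *ᵥ fun p => X p.1.val p.2) (k, a)
      = (∑ l ∈ Finset.range (m + 1), s (k.val + l) *ᵥ X l) a := by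
  rw [Finset.sum_range, Finset.sum_apply]
  simp only [mulVec, dotProduct, hank, of_apply]
  rw [Fintype.sum_prod_type]

theorem aux_hank_zero (q m : ℕ) (s : ℕ → Matrix (Fin q) (Fin q) ℂ) (X : ℕ → Fin q → ℂ) :
    (hank q m s *ᵥ fun p => X p.1.val p.2) = 0 ↔
      ∀ k ≤ m, ∑ l ∈ Finset.range (m + 1), s (k + l) *ᵥ X l = 0 := by
  constructor
  · intro h k hk
    ext a
    have := congrFun h (⟨k, by omega⟩, a)
    rw [aux_hank_mulVec] at this
    simpa using this
  · intro h
    ext ⟨k, a⟩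
    rw [aux_hank_mulVec, h k.val (by omega)]
    rfl

/-- Key lemma: the kernel is shift stable. -/
theorem aux_shift (q m : ℕ) (s : ℕ → Matrix (Fin q) (Fin q) ℂ) (X : ℕ → Fin q → ℂ)
    (hH : (hank q (m + 1) s).PosSemidef)
    (hX : ∀ k ≤ m, ∑ l ∈ Finset.range (m + 1), s (k + l) *ᵥ X l = 0) :
    ∑ l ∈ Finset.range (m + 1), s (m + 1 + l) *ᵥ X l = 0 := by
  let X' : ℕ → Fin q → ℂ := fun l => if l ≤ m then X l else 0
  have hs : ∀ k, ∑ l ∈ Finset.range (m + 1 + 1), s (k + l) *ᵥ X' l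
      = ∑ l ∈ Finset.range (m + 1), s (k + l) *ᵥ X l := by
    intro k
    rw [Finset.sum_range_succ]
    have : X' (m + 1) = 0 := by simp [X']
    rw [this, mulVec_zero, add_zero]
    refine Finset.sum_congr rfl fun l hl => ?_
    have : l ≤ m := by simpa [Nat.lt_succ_iff] using hl
    simp [X', this]
  have hz : (hank q (m + 1) s *ᵥ fun p => X' p.1.val p.2) = 0 := by
    rw [← hH.dotProduct_mulVec_zero_iff]
    rw [dotProduct]
    refine Finset.sum_eq_zero fun p _ => ?_
    obtain ⟨k, a⟩ := p
    rw [aux_hank_mulVec, hs]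
    by_cases hk : k.val ≤ m
    · rw [hX _ hk]; simp
    · simp [X', hk]
  rw [← hs]
  exact (aux_hank_zero q (m + 1) s X').1 hz (m + 1) le_rfl

theorem aux_hank_mono (q : ℕ) {m n : ℕ} (h : m ≤ n) (s : ℕ → Matrix (Fin q) (Fin q) ℂ)
    (hH : (hank q n s).PosSemidef) : (hank q m s).PosSemidef := by
  have := hH.submatrix (fun p : Fin (m + 1) × Fin q => (Fin.castLE (by omega : m + 1 ≤ n + 1) p.1, p.2))
  exact this

def auxZ (q m : ℕ) (s : ℕ → Matrix (Fin q) (Fin q) ℂ) : Matrix (Fin q) (Fin (m + 1) × Fin q) ℂ :=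
  Matrix.of fun (a : Fin q) (j : Fin (m + 1) × Fin q) => s ((m + 1) + j.1.val) a j.2

def auxY (q m : ℕ) (s : ℕ → Matrix (Fin q) (Fin q) ℂ) : Matrix (Fin (m + 1) × Fin q) (Fin q) ℂ :=
  Matrix.of fun (j : Fin (m + 1) × Fin q) (b : Fin q) => s ((m + 1) + j.1.val) j.2 b

theorem aux_LS_succ (q m : ℕ) (s : ℕ → Matrix (Fin q) (Fin q) ℂ) :
    LS q s (m + 1) = s (2 * (m + 1)) - auxZ q m s * mp (hank q m s) * auxY q m s := rfl

theorem aux_Z_mulVec (q m : ℕ) (s : ℕ → Matrix (Fin q) (Fin q) ℂ) (X : ℕ → Fin q → ℂ) :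
    (auxZ q m s *ᵥ fun p => X p.1.val p.2)
      = ∑ l ∈ Finset.range (m + 1), s (m + 1 + l) *ᵥ X l := by
  ext a
  rw [Finset.sum_range, Finset.sum_apply]
  simp only [mulVec, dotProduct, auxZ, of_apply]
  rw [Fintype.sum_prod_type]

theorem aux_Y_mulVec (q m : ℕ) (s : ℕ → Matrix (Fin q) (Fin q) ℂ) (v : Fin q → ℂ)
    (k : Fin (m + 1)) (a : Fin q) :
    (auxY q m s *ᵥ v) (k, a) = (s (m + 1 + k.val) *ᵥ v) a := rfl

theorem aux_ext (q m : ℕ) (x : Fin (m + 1) × Fin q → ℂ) :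
    ∃ X : ℕ → Fin q → ℂ, x = fun p => X p.1.val p.2 := by
  refine ⟨fun l b => if h : l < m + 1 then x (⟨l, h⟩, b) else 0, ?_⟩
  ext ⟨k, a⟩
  simp only [k.isLt, dif_pos]

theorem aux_ZH (q m : ℕ) (s : ℕ → Matrix (Fin q) (Fin q) ℂ)
    (hH : (hank q (m + 1) s).PosSemidef) :
    (auxY q m s)ᴴ = auxZ q m s ∧ (auxZ q m s)ᴴ = auxY q m s := by
  have h : (auxY q m s)ᴴ = auxZ q m s := by
    ext a ⟨l, b⟩
    have := congrFun (congrFun hH.1 (Fin.last (m + 1), a)) (l.castSucc, b)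
    simpa [hank, auxY, auxZ, conjTranspose_apply, add_comm, add_left_comm] using this
  exact ⟨h, by rw [← h, conjTranspose_conjTranspose]⟩

theorem aux_Z_ker (q m : ℕ) (s : ℕ → Matrix (Fin q) (Fin q) ℂ)
    (hH : (hank q (m + 1) s).PosSemidef) (u : Fin (m + 1) × Fin q → ℂ)
    (hu : hank q m s *ᵥ u = 0) : auxZ q m s *ᵥ u = 0 := by
  obtain ⟨X, rfl⟩ := aux_ext q m u
  rw [aux_Z_mulVec]
  exact aux_shift q m s X hH ((aux_hank_zero q m s X).1 hu)

theorem aux_ZXH (q m : ℕ) (s : ℕ → Matrix (Fin q) (Fin q) ℂ)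
    (hH : (hank q (m + 1) s).PosSemidef) :
    auxZ q m s * (mp (hank q m s) * hank q m s) = auxZ q m s := by
  have hm := aux_hank_mono q (Nat.le_succ m) s hH
  obtain ⟨h1, h2, h3, h4⟩ := aux_mp_spec _ hm.1
  rw [← sub_eq_zero]
  apply Matrix.ext_of_mulVec_single
  intro i
  have : auxZ q m s * (mp (hank q m s) * hank q m s) - auxZ q m s
    = auxZ q m s * (mp (hank q m s) * hank q m s - 1) := by
    rw [Matrix.mul_sub, Matrix.mul_one]
  rw [this, ← mulVec_mulVec, zero_mulVec]
  apply aux_Z_ker q m s hH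
  rw [mulVec_mulVec, Matrix.mul_sub, Matrix.mul_one, ← Matrix.mul_assoc, h1, sub_self, zero_mulVec]

theorem aux_HXY (q m : ℕ) (s : ℕ → Matrix (Fin q) (Fin q) ℂ)
    (hH : (hank q (m + 1) s).PosSemidef) :
    hank q m s * (mp (hank q m s) * auxY q m s) = auxY q m s ∧
    ∃ W : Matrix (Fin (m + 1) × Fin q) (Fin q) ℂ, auxY q m s = hank q m s * W := by
  have hm := aux_hank_mono q (Nat.le_succ m) s hH
  obtain ⟨h1, h2, h3, h4⟩ := aux_mp_spec _ hm.1
  have h := congrArg conjTranspose (aux_ZXH q m s hH)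
  rw [conjTranspose_mul, conjTranspose_mul, (aux_ZH q m s hH).2, hm.1, Matrix.mul_assoc] at h
  refine ⟨?_, _, h.symm⟩
  conv_lhs => rw [← h]
  rw [← Matrix.mul_assoc, ← Matrix.mul_assoc, h1, h]

theorem aux_s_herm (q m : ℕ) (s : ℕ → Matrix (Fin q) (Fin q) ℂ)
    (hH : (hank q m s).PosSemidef) : (s (2 * m))ᴴ = s (2 * m) := by
  ext a b
  have := congrFun (congrFun hH.1 (Fin.last m, a)) (Fin.last m, b)
  simpa [hank, conjTranspose_apply, two_mul] using this

theorem aux_LS_herm (q m : ℕ) (s : ℕ → Matrix (Fin q) (Fin q) ℂ)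
    (hH : (hank q m s).PosSemidef) : (LS q s m)ᴴ = LS q s m := by
  cases m with
  | zero => exact aux_s_herm q 0 s hH
  | succ m =>
    rw [aux_LS_succ, conjTranspose_sub, aux_s_herm q (m + 1) s hH]
    congr 1
    have hm := aux_hank_mono q (Nat.le_succ m) s hH
    obtain ⟨h1, h2, h3, h4⟩ := aux_mp_spec _ hm.1
    obtain ⟨W, hW⟩ := (aux_HXY q m s hH).2
    have hZ : auxZ q m s = Wᴴ * hank q m s := by
      rw [← (aux_ZH q m s hH).1, hW, conjTranspose_mul, hm.1]
    have : auxZ q m s * mp (hank q m s) * auxY q m s = Wᴴ * hank q m s * W := by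
      rw [hZ, hW]
      calc _ = Wᴴ * (hank q m s * mp (hank q m s) * hank q m s) * W := by
            simp only [Matrix.mul_assoc]
        _ = _ := by rw [h1]
    rw [this, conjTranspose_mul, conjTranspose_mul, hm.1, conjTranspose_conjTranspose,
      Matrix.mul_assoc]

theorem aux_LS_ker (q m : ℕ) (s : ℕ → Matrix (Fin q) (Fin q) ℂ)
    (hH : (hank q m s).PosSemidef) (v : Fin q → ℂ) :
    LS q s m *ᵥ v = 0 ↔ ∃ X : ℕ → Fin q → ℂ, X m = v ∧
      ∀ k ≤ m, ∑ l ∈ Finset.range (m + 1), s (k + l) *ᵥ X l = 0 := by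
  cases m with
  | zero =>
    constructor
    · intro h
      refine ⟨fun _ => v, rfl, fun k hk => ?_⟩
      obtain rfl : k = 0 := by omega
      simpa [LS] using h
    · rintro ⟨X, rfl, h⟩
      simpa [LS] using h 0 le_rfl
  | succ m =>
    have hm := aux_hank_mono q (Nat.le_succ m) s hH
    obtain ⟨h1, h2, h3, h4⟩ := aux_mp_spec _ hm.1
    have hL : LS q s (m + 1) *ᵥ v = s (m + 1 + (m + 1)) *ᵥ v
        - auxZ q m s *ᵥ (mp (hank q m s) *ᵥ (auxY q m s *ᵥ v)) := by
      rw [aux_LS_succ, sub_mulVec, mulVec_mulVec, mulVec_mulVec, two_mul, Matrix.mul_assoc]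
    constructor
    · intro h
      obtain ⟨X0, hX0⟩ := aux_ext q m (-(mp (hank q m s) *ᵥ (auxY q m s *ᵥ v)))
      have hs : ∀ k, ∑ l ∈ Finset.range (m + 1 + 1),
          s (k + l) *ᵥ (if l ≤ m then X0 l else v)
          = ∑ l ∈ Finset.range (m + 1), s (k + l) *ᵥ X0 l + s (k + (m + 1)) *ᵥ v := by
        intro k
        rw [Finset.sum_range_succ]
        congr 1
        · refine Finset.sum_congr rfl fun l hl => ?_
          have : l ≤ m := by simpa [Nat.lt_succ_iff] using hl
          simp [this]
        · simp
      refine ⟨fun l => if l ≤ m then X0 l else v, by simp, fun k hk => ?_⟩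
      rw [hs]
      rcases Nat.lt_or_ge k (m + 1) with hk' | hk'
      · ext a
        have e := aux_hank_mulVec q m s X0 ⟨k, hk'⟩ a
        rw [← hX0, mulVec_neg, mulVec_mulVec, mulVec_mulVec, Matrix.mul_assoc,
          (aux_HXY q m s hH).1, Pi.neg_apply, aux_Y_mulVec] at e
        simp only at e
        rw [Pi.add_apply, ← e, add_comm k]
        simp
      · obtain rfl : k = m + 1 := by omega
        rw [← aux_Z_mulVec, ← hX0, mulVec_neg, neg_add_eq_sub, ← hL, h]
    · rintro ⟨X, rfl, h⟩
      have hY : auxY q m s *ᵥ X (m + 1) = -(hank q m s *ᵥ fun p => X p.1.val p.2) := by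
        ext ⟨k, a⟩
        have := congrFun (h k.val (by omega)) a
        rw [Finset.sum_range_succ, Pi.add_apply] at this
        rw [aux_Y_mulVec, Pi.neg_apply, aux_hank_mulVec, add_comm (m + 1)]
        exact eq_neg_of_add_eq_zero_right this
      rw [hL, hY, mulVec_neg, mulVec_neg, mulVec_mulVec, mulVec_mulVec, Matrix.mul_assoc,
        aux_ZXH q m s hH,
        aux_Z_mulVec]
      have := h (m + 1) le_rfl
      rw [Finset.sum_range_succ] at this
      rw [sub_neg_eq_add, add_comm, this]

theorem aux_LS_incl (q m : ℕ) (α : ℝ) (s : ℕ → Matrix (Fin q) (Fin q) ℂ)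
    (hH : (hank q (m + 1) s).PosSemidef) (hα : (hank q m (sShift α s)).PosSemidef)
    (v : Fin q → ℂ) (hv : LS q s m *ᵥ v = 0) : LS q (sShift α s) m *ᵥ v = 0 := by
  rw [aux_LS_ker q m s (aux_hank_mono q (Nat.le_succ m) s hH)] at hv
  obtain ⟨X, hX, h⟩ := hv
  rw [aux_LS_ker q m _ hα]
  refine ⟨X, hX, fun k hk => ?_⟩
  have h' : ∑ l ∈ Finset.range (m + 1), s (k + 1 + l) *ᵥ X l = 0 := by
    rcases Nat.lt_or_ge k m with hk' | hk'
    · exact h (k + 1) hk'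
    · obtain rfl : k = m := by omega
      exact aux_shift q k s X hH h
  have : ∀ l, sShift α s (k + l) *ᵥ X l
      = (-(α : ℂ)) • (s (k + l) *ᵥ X l) + s (k + 1 + l) *ᵥ X l := by
    intro l
    rw [sShift, add_mulVec, smul_mulVec, Nat.add_right_comm]
  simp only [this]
  rw [Finset.sum_add_distrib, ← Finset.smul_sum, h k hk, h', smul_zero, add_zero]

theorem aux_hank_congr (q m : ℕ) (s t : ℕ → Matrix (Fin q) (Fin q) ℂ)
    (h : ∀ j ≤ 2 * m, s j = t j) : hank q m s = hank q m t := by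
  ext ⟨j, a⟩ ⟨k, b⟩
  simp only [hank, of_apply]
  rw [h _ (by omega)]

theorem aux_LS_congr (q m : ℕ) (s t : ℕ → Matrix (Fin q) (Fin q) ℂ)
    (h : ∀ j ≤ 2 * m, s j = t j) : LS q s m = LS q t m := by
  cases m with
  | zero => exact h 0 le_rfl
  | succ m =>
    have hZ : auxZ q m s = auxZ q m t := by
      ext a ⟨k, b⟩
      simp only [auxZ, of_apply]
      rw [h _ (by omega)]
    have hY : auxY q m s = auxY q m t := by
      ext ⟨k, b⟩ a
      simp only [auxY, of_apply]
      rw [h _ (by omega)]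
    rw [aux_LS_succ, aux_LS_succ, hZ, hY, h _ le_rfl,
      aux_hank_congr q m s t (fun j hj => h j (by omega))]

theorem aux_Ldiag_congr (q n : ℕ) (s t : ℕ → Matrix (Fin q) (Fin q) ℂ)
    (h : ∀ j ≤ 2 * n, s j = t j) : Ldiag q n s = Ldiag q n t := by
  ext ⟨j, a⟩ ⟨k, b⟩
  simp only [Ldiag, of_apply]
  rw [aux_LS_congr q j.val s t (fun i hi => h i (by omega))]

theorem aux_Ldiag_mulVec (q n : ℕ) (s : ℕ → Matrix (Fin q) (Fin q) ℂ)
    (x : Fin (n + 1) × Fin q → ℂ) (j : Fin (n + 1)) (a : Fin q) :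
    (Ldiag q n s *ᵥ x) (j, a) = (LS q s j.val *ᵥ fun b => x (j, b)) a := by
  simp only [mulVec, dotProduct, Ldiag, of_apply]
  rw [Fintype.sum_prod_type, Finset.sum_eq_single j]
  · simp
  · intro k _ hk
    simp [Ne.symm hk]
  · simp

theorem aux_Ldiag_herm (q n : ℕ) (s : ℕ → Matrix (Fin q) (Fin q) ℂ)
    (hH : (hank q n s).PosSemidef) : (Ldiag q n s)ᴴ = Ldiag q n s := by
  ext ⟨j, a⟩ ⟨k, b⟩
  simp only [conjTranspose_apply, Ldiag, of_apply]
  by_cases h : j = k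
  · subst h
    have := congrFun (congrFun
      (aux_LS_herm q j.val s (aux_hank_mono q (by omega) s hH)) a) b
    simpa using this
  · simp [h, Ne.symm h]

/-- Lemma (311-1): properties of the generalized inverses `H_n^⊐` and `H_{α▷n}^⊐` for an
α-Stieltjes nonnegative definite extendable sequence `(s_j)_{j=0}^{2n+1}`. -/
theorem restricted_generalized_inverses_of_hankel_matrices
    (q : ℕ) (hq : 1 ≤ q) (α : ℝ) (n : ℕ) (s : ℕ → Matrix (Fin q) (Fin q) ℂ)
    (hK : ∃ t : ℕ → Matrix (Fin q) (Fin q) ℂ,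
      (∀ j ≤ 2 * n + 1, t j = s j) ∧
        (hank q (n + 1) t).PosSemidef ∧ (hank q n (sShift α t)).PosSemidef)
    (G Gα : Matrix (Fin (n + 1) × Fin q) (Fin (n + 1) × Fin q) ℂ)
    (hG : IsRGI (hank q n s) G (Dsub q n s))
    (hGα : IsRGI (hank q n (sShift α s)) Gα (Dsub q n (sShift α s))) :
    G.PosSemidef ∧ Gα.PosSemidef ∧ Gᴴ = G ∧ Gαᴴ = Gα ∧
    hank q n s * G * hank q n s = hank q n s ∧
    G * hank q n s * G = G ∧
    hank q n (sShift α s) * Gα * hank q n (sShift α s) = hank q n (sShift α s) ∧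
    Gα * hank q n (sShift α s) * Gα = Gα ∧
    G * hank q n s * Gα = Gα ∧
    Gα * hank q n s * G = Gα := by
  obtain ⟨t, hts, hH, hα⟩ := hK
  have hst : ∀ j ≤ 2 * n, s j = t j := fun j hj => (hts j (by omega)).symm
  have hstα : ∀ j ≤ 2 * n, sShift α s j = sShift α t j := fun j hj => by
    simp only [sShift]
    rw [hts j (by omega), hts (j + 1) (by omega)]
  have hHs : (hank q n s).PosSemidef := by
    rw [aux_hank_congr q n s t hst]
    exact aux_hank_mono q (Nat.le_succ n) t hH
  have hHα : (hank q n (sShift α s)).PosSemidef := by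
    rwa [aux_hank_congr q n _ _ hstα]
  have eG := aux_rgi hHs.1 hG
  have eGα := aux_rgi hHα.1 hGα
  have pG : G.PosSemidef := by
    rw [eG]
    exact hHs.mul_mul_conjTranspose_same G
  have pGα : Gα.PosSemidef := by
    rw [eGα]
    exact hHα.mul_mul_conjTranspose_same Gα
  have main : Gα * hank q n s * G = Gα := by
    have : Gα * (1 - hank q n s * G) = 0 := by
      apply Matrix.ext_of_mulVec_single
      intro i
      have hx : G *ᵥ ((1 - hank q n s * G) *ᵥ Pi.single i 1) = 0 := by
        rw [mulVec_mulVec, Matrix.mul_sub, Matrix.mul_one, ← Matrix.mul_assoc, hG.2.1, sub_self,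
          zero_mulVec]
      rw [zero_mulVec, ← mulVec_mulVec]
      generalize ((1 - hank q n s * G) *ᵥ Pi.single i 1) = x at hx ⊢
      rw [hG.2.2.2, Dsub, aux_perp, aux_Ldiag_herm q n s hHs, aux_Ldiag_congr q n s t hst] at hx
      rw [hGα.2.2.2, Dsub, aux_perp, aux_Ldiag_herm q n _ hHα, aux_Ldiag_congr q n _ _ hstα]
      ext ⟨j, a⟩
      rw [aux_Ldiag_mulVec, aux_LS_incl q j.val α t (aux_hank_mono q (by omega) t hH)
        (aux_hank_mono q (by omega) _ hα)]
      · rfl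
      · ext b
        rw [← aux_Ldiag_mulVec, hx]
        rfl
    rw [Matrix.mul_sub, Matrix.mul_one, ← Matrix.mul_assoc, sub_eq_zero] at this
    exact this.symm
  refine ⟨pG, pGα, pG.1, pGα.1, hG.1, hG.2.1, hGα.1, hGα.2.1, ?_, main⟩
  have := congrArg conjTranspose main
  rwa [conjTranspose_mul, conjTranspose_mul, pG.1, pGα.1, hHs.1, ← Matrix.mul_assoc] at this
end

section
/- Let q ≥ 1, α ∈ ℝ, n ∈ ℕ₀, and (s_j)_{j=0}^{2n+1} ∈ K≥,e_{α,q,2n+1}; write T := T_{q,n} and I := I_{(n+1)q}. Then for every ζ ∈ ℂ and every k ∈ ℕ₀: H_n^⊐·R_T(ζ)·T^k·(I − H_n·H_n^⊐) = 0, (I − H_n^⊐·H_n)·(T*)^k·(R_T(ζ))*·H_n^⊐ = 0, H_{α▷n}^⊐·R_T(ζ)·T^k·(I − H_{α▷n}·H_{α▷n}^⊐) = 0, and (I − H_{α▷n}^⊐·H_{α▷n})·(T*)^k·(R_T(ζ))*·H_{α▷n}^⊐ = 0. Furthermore, for every ζ ∈ ℂ and every integer k ≥ 1: H_n^⊐·R_T(ζ)·T^k·(I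 − H_{α▷n}·H_{α▷n}^⊐) = 0 and (I − H_{α▷n}^⊐·H_{α▷n})·(T*)^k·(R_T(ζ))*·H_n^⊐ = 0. -/
open Matrix ComplexConjugate
open scoped ComplexOrder

lemma hank_mulVec (q n : ℕ) (s : ℕ → Matrix (Fin q) (Fin q) ℂ) (x : ℕ → Fin q → ℂ)
    (k : Fin (n+1)) (a : Fin q) :
    (hank q n s *ᵥ (fun p => x p.1.val p.2)) (k, a) =
      (∑ l ∈ Finset.range (n+1), s (k.val + l) *ᵥ x l) a := by
  rw [Finset.sum_range, Finset.sum_apply]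
  simp only [Matrix.mulVec, dotProduct, hank, Matrix.of_apply]
  rw [Fintype.sum_prod_type]

lemma hank_psd_mono (q m n : ℕ) (h : m ≤ n) (s : ℕ → Matrix (Fin q) (Fin q) ℂ)
    (H : (hank q n s).PosSemidef) : (hank q m s).PosSemidef := by
  have := H.submatrix (fun p : Fin (m+1) × Fin q => (Fin.castLE (by omega) p.1, p.2))
  exact this

lemma hank_ker_iff (q n : ℕ) (s : ℕ → Matrix (Fin q) (Fin q) ℂ) (x : ℕ → Fin q → ℂ) :
    hank q n s *ᵥ (fun p => x p.1.val p.2) = 0 ↔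
      ∀ k ≤ n, ∑ l ∈ Finset.range (n+1), s (k + l) *ᵥ x l = 0 := by
  constructor
  · intro h k hk
    ext a
    have := congrFun h (⟨k, by omega⟩, a)
    rwa [hank_mulVec] at this
  · intro h
    ext ⟨k, a⟩
    rw [hank_mulVec, h k.val (by omega)]
    rfl

/-- Lemma B -/
lemma ker_ext (q n : ℕ) (s : ℕ → Matrix (Fin q) (Fin q) ℂ)
    (H : (hank q (n+1) s).PosSemidef) (x : ℕ → Fin q → ℂ)
    (hx : ∀ k ≤ n, ∑ l ∈ Finset.range (n+1), s (k + l) *ᵥ x l = 0) :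
    ∀ k ≤ n + 1, ∑ l ∈ Finset.range (n+1), s (k + l) *ᵥ x l = 0 := by
  set y : ℕ → Fin q → ℂ := fun l => if l < n + 1 then x l else 0 with hy
  have key : ∀ k, ∑ l ∈ Finset.range (n+1+1), s (k + l) *ᵥ y l =
      ∑ l ∈ Finset.range (n+1), s (k + l) *ᵥ x l := by
    intro k
    rw [Finset.sum_range_succ]
    simp only [hy, lt_irrefl, if_false, Matrix.mulVec_zero, add_zero]
    apply Finset.sum_congr rfl
    intro l hl
    rw [if_pos (Finset.mem_range.mp hl)]
  have h0 : hank q (n+1) s *ᵥ (fun p => y p.1.val p.2) = 0 := by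
    rw [← H.dotProduct_mulVec_zero_iff]
    rw [dotProduct]
    apply Finset.sum_eq_zero
    rintro ⟨k, a⟩ -
    rw [hank_mulVec, key]
    by_cases hk : k.val < n + 1
    · rw [hx _ (by omega)]; simp
    · have : y k.val = 0 := by simp only [hy]; rw [if_neg hk]
      simp [this]
  intro k hk
  rw [← key]
  exact (hank_ker_iff q (n+1) s y).1 h0 k hk

lemma mp_spec {m : Type*} [Fintype m] [DecidableEq m] (A : Matrix m m ℂ) (hA : A.IsHermitian) :
    A * mp A * A = A ∧ mp A * A * mp A = mp A ∧ (A * mp A)ᴴ = A * mp A ∧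
      (mp A * A)ᴴ = mp A * A := by
  have h : ∃ X : Matrix m m ℂ,
      A * X * A = A ∧ X * A * X = X ∧ (A * X)ᴴ = A * X ∧ (X * A)ᴴ = X * A := by
    obtain ⟨U, d, hU, hA'⟩ : ∃ (U : Matrix m m ℂ) (d : m → ℝ), Uᴴ * U = 1 ∧
        A = U * diagonal (fun i => (d i : ℂ)) * Uᴴ := by
      refine ⟨hA.eigenvectorUnitary, hA.eigenvalues, ?_, ?_⟩
      · exact (Matrix.mem_unitaryGroup_iff'.1 hA.eigenvectorUnitary.2)
      · exact hA.spectral_theorem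
    have e : ∀ f g : m → ℂ, (U * diagonal f * Uᴴ) * (U * diagonal g * Uᴴ) =
        U * diagonal (f * g) * Uᴴ := by
      intro f g
      calc _ = U * diagonal f * (Uᴴ * U) * diagonal g * Uᴴ := by simp only [Matrix.mul_assoc]
        _ = U * (diagonal f * diagonal g) * Uᴴ := by
          rw [hU, Matrix.mul_one]; simp only [Matrix.mul_assoc]
        _ = _ := by rw [diagonal_mul_diagonal]; rfl
    refine ⟨U * diagonal (fun i => ((d i : ℂ))⁻¹) * Uᴴ, ?_, ?_, ?_, ?_⟩
    · rw [hA', e, e]; congr 3; ext i; by_cases h : (d i) = 0 <;> simp [h]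
    · rw [hA', e, e]; congr 3; ext i; by_cases h : (d i) = 0 <;> simp [h]
    · rw [hA', e]
      rw [conjTranspose_mul, conjTranspose_mul, conjTranspose_conjTranspose, Matrix.mul_assoc,
        diagonal_conjTranspose]
      congr 3; ext i; simp
    · rw [hA', e]
      rw [conjTranspose_mul, conjTranspose_mul, conjTranspose_conjTranspose, Matrix.mul_assoc,
        diagonal_conjTranspose]
      congr 3; ext i; simp
  unfold mp
  rw [dif_pos h]
  exact h.choose_spec

lemma s_herm (q n : ℕ) (s : ℕ → Matrix (Fin q) (Fin q) ℂ)
    (H : (hank q n s).IsHermitian) (i j : ℕ) (hi : i ≤ n) (hj : j ≤ n) :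
    (s (i + j))ᴴ = s (i + j) := by
  ext a b
  have := congrFun (congrFun H (⟨i, by omega⟩, a)) (⟨j, by omega⟩, b)
  simpa [hank, add_comm] using this

def Zr (q n : ℕ) (s : ℕ → Matrix (Fin q) (Fin q) ℂ) : Matrix (Fin q) (Fin (n+1) × Fin q) ℂ :=
  Matrix.of fun (a : Fin q) (j : Fin (n + 1) × Fin q) => s ((n + 1) + j.1.val) a j.2

def Yc (q n : ℕ) (s : ℕ → Matrix (Fin q) (Fin q) ℂ) : Matrix (Fin (n+1) × Fin q) (Fin q) ℂ :=
  Matrix.of fun (j : Fin (n + 1) × Fin q) (b : Fin q) => s ((n + 1) + j.1.val) j.2 b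

lemma LS_succ (q n : ℕ) (s : ℕ → Matrix (Fin q) (Fin q) ℂ) :
    LS q s (n+1) = s (2 * (n+1)) - Zr q n s * mp (hank q n s) * Yc q n s := rfl

lemma Zr_mulVec (q n : ℕ) (s : ℕ → Matrix (Fin q) (Fin q) ℂ) (x : ℕ → Fin q → ℂ) :
    Zr q n s *ᵥ (fun p => x p.1.val p.2) =
      ∑ l ∈ Finset.range (n+1), s (n + 1 + l) *ᵥ x l := by
  ext a
  rw [Finset.sum_range, Finset.sum_apply]
  simp only [Matrix.mulVec, dotProduct, Zr, Matrix.of_apply]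
  rw [Fintype.sum_prod_type]

lemma Yc_mulVec (q n : ℕ) (s : ℕ → Matrix (Fin q) (Fin q) ℂ) (v : Fin q → ℂ)
    (k : Fin (n+1)) (a : Fin q) :
    (Yc q n s *ᵥ v) (k, a) = (s (k.val + (n + 1)) *ᵥ v) a := by
  rw [add_comm k.val (n+1)]; rfl

/-- extension of a vector to a sequence -/
def extv {q n : ℕ} (w : Fin (n+1) × Fin q → ℂ) : ℕ → Fin q → ℂ :=
  fun l a => if h : l < n + 1 then w (⟨l, h⟩, a) else 0

lemma extv_spec {q n : ℕ} (w : Fin (n+1) × Fin q → ℂ) :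
    (fun p : Fin (n+1) × Fin q => extv w p.1.val p.2) = w := by
  ext ⟨k, a⟩
  simp only [extv]
  rw [dif_pos k.2]

lemma Zr_ker (q n : ℕ) (s : ℕ → Matrix (Fin q) (Fin q) ℂ)
    (H : (hank q (n+1) s).PosSemidef) (w : Fin (n+1) × Fin q → ℂ)
    (hw : hank q n s *ᵥ w = 0) : Zr q n s *ᵥ w = 0 := by
  rw [← extv_spec w] at hw ⊢
  rw [Zr_mulVec]
  exact ker_ext q n s H _ ((hank_ker_iff q n s _).1 hw) (n+1) le_rfl

lemma Zr_ker_mat (q n : ℕ) (s : ℕ → Matrix (Fin q) (Fin q) ℂ)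
    (H : (hank q (n+1) s).PosSemidef)
    (W : Matrix (Fin (n+1) × Fin q) (Fin (n+1) × Fin q) ℂ)
    (hw : hank q n s * W = 0) : Zr q n s * W = 0 := by
  apply Matrix.ext_of_mulVec_single
  intro i
  rw [← Matrix.mulVec_mulVec, Matrix.zero_mulVec]
  apply Zr_ker q n s H
  rw [Matrix.mulVec_mulVec, hw, Matrix.zero_mulVec]

lemma Zr_conj (q n : ℕ) (s : ℕ → Matrix (Fin q) (Fin q) ℂ)
    (H : (hank q (n+1) s).PosSemidef) : (Zr q n s)ᴴ = Yc q n s := by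
  ext ⟨k, a⟩ b
  have := s_herm q (n+1) s H.1 (n+1) k.val le_rfl (by omega)
  exact congrFun (congrFun this a) b

lemma Z_facts (q n : ℕ) (s : ℕ → Matrix (Fin q) (Fin q) ℂ)
    (H : (hank q (n+1) s).PosSemidef) :
    Zr q n s * (mp (hank q n s) * hank q n s) = Zr q n s ∧
    Zr q n s * (hank q n s * mp (hank q n s)) = Zr q n s ∧
    hank q n s * mp (hank q n s) * Yc q n s = Yc q n s := by
  have HA := (hank_psd_mono q n (n+1) (by omega) s H).1
  obtain ⟨h1, h2, h3, h4⟩ := mp_spec _ HA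
  have f1 : Zr q n s * (1 - mp (hank q n s) * hank q n s) = 0 := by
    apply Zr_ker_mat q n s H
    rw [Matrix.mul_sub, ← Matrix.mul_assoc, h1, Matrix.mul_one, sub_self]
  have f2 : Zr q n s * (1 - hank q n s * mp (hank q n s)) = 0 := by
    apply Zr_ker_mat q n s H
    have : hank q n s * (hank q n s * mp (hank q n s)) = hank q n s := by
      have := congrArg conjTranspose h1
      rwa [conjTranspose_mul, h3, HA.eq] at this
    rw [Matrix.mul_sub, this, Matrix.mul_one, sub_self]
  rw [Matrix.mul_sub, Matrix.mul_one, sub_eq_zero] at f1 f2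
  refine ⟨f1.symm, f2.symm, ?_⟩
  have := congrArg conjTranspose f2
  rw [conjTranspose_mul, h3, Zr_conj q n s H] at this
  exact this.symm

lemma LS_herm (q n : ℕ) (s : ℕ → Matrix (Fin q) (Fin q) ℂ)
    (H : (hank q n s).PosSemidef) : (LS q s n)ᴴ = LS q s n := by
  cases n with
  | zero => exact s_herm q 0 s H.1 0 0 le_rfl le_rfl
  | succ n =>
    have HA := (hank_psd_mono q n (n+1) (by omega) s H).1
    obtain ⟨h1, h2, h3, h4⟩ := mp_spec _ HA
    obtain ⟨f1, f2, f3⟩ := Z_facts q n s H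
    have hY : (Yc q n s)ᴴ = Zr q n s := by rw [← Zr_conj q n s H, conjTranspose_conjTranspose]
    rw [LS_succ, conjTranspose_sub, conjTranspose_mul, conjTranspose_mul, hY, Zr_conj q n s H]
    have := s_herm q (n+1) s H.1 (n+1) (n+1) le_rfl le_rfl
    rw [← two_mul] at this
    rw [this]
    congr 1
    have e : (mp (hank q n s))ᴴ * hank q n s = hank q n s * mp (hank q n s) := by
      rw [conjTranspose_mul, HA.eq] at h3
      exact h3
    calc Zr q n s * ((mp (hank q n s))ᴴ * Yc q n s)
        = Zr q n s * ((mp (hank q n s))ᴴ * hank q n s) * mp (hank q n s) * Yc q n s := by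
          nth_rewrite 1 [← f3]; simp only [Matrix.mul_assoc]
      _ = _ := by rw [e, f2]

/-- Lemma A -/
lemma LS_ker (q n : ℕ) (s : ℕ → Matrix (Fin q) (Fin q) ℂ)
    (H : (hank q n s).PosSemidef) (v : Fin q → ℂ) :
    LS q s n *ᵥ v = 0 ↔ ∃ x : ℕ → Fin q → ℂ, x n = v ∧
      ∀ k ≤ n, ∑ l ∈ Finset.range (n+1), s (k + l) *ᵥ x l = 0 := by
  cases n with
  | zero =>
    constructor
    · intro h
      refine ⟨fun _ => v, rfl, ?_⟩
      intro k hk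
      obtain rfl : k = 0 := by omega
      simpa [LS] using h
    · rintro ⟨x, rfl, h⟩
      simpa [LS] using h 0 le_rfl
  | succ n =>
    obtain ⟨f1, f2, f3⟩ := Z_facts q n s H
    have two : s (2 * (n+1)) = s (n + 1 + (n+1)) := by rw [two_mul]
    constructor
    · intro h
      set w := mp (hank q n s) *ᵥ (Yc q n s *ᵥ v) with hw
      refine ⟨fun l => if l = n + 1 then v else - extv w l, by simp, ?_⟩
      have key : ∀ k, ∑ l ∈ Finset.range (n+1+1), s (k + l) *ᵥ
          (if l = n + 1 then v else - extv w l) =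
          s (k + (n+1)) *ᵥ v - ∑ l ∈ Finset.range (n+1), s (k + l) *ᵥ extv w l := by
        intro k
        rw [Finset.sum_range_succ, if_pos rfl, add_comm, sub_eq_add_neg, ← Finset.sum_neg_distrib]
        congr 1
        apply Finset.sum_congr rfl
        intro l hl
        rw [if_neg (by have := Finset.mem_range.mp hl; omega), Matrix.mulVec_neg]
      intro k hk
      rw [key, sub_eq_zero]
      rcases Nat.lt_or_ge k (n+1) with hk' | hk'
      · ext a
        have e : hank q n s *ᵥ w = Yc q n s *ᵥ v := by
          rw [hw, Matrix.mulVec_mulVec, Matrix.mulVec_mulVec, f3]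
        have := congrFun e (⟨k, hk'⟩, a)
        rw [Yc_mulVec] at this
        rw [← this]
        nth_rewrite 1 [← extv_spec w]
        rw [hank_mulVec]
      · obtain rfl : k = n + 1 := by omega
        rw [← Zr_mulVec, extv_spec, ← two, hw, Matrix.mulVec_mulVec, Matrix.mulVec_mulVec,
          ← sub_eq_zero, ← Matrix.sub_mulVec]
        exact h
    · rintro ⟨x, rfl, h⟩
      have a1 : Yc q n s *ᵥ x (n+1) = - (hank q n s *ᵥ fun p => x p.1.val p.2) := by
        ext ⟨k, a⟩
        rw [Yc_mulVec, Pi.neg_apply, hank_mulVec]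
        have := h k.val (by omega)
        rw [Finset.sum_range_succ] at this
        rw [eq_neg_of_add_eq_zero_right this]; rfl
      have a2 := h (n+1) le_rfl
      rw [Finset.sum_range_succ, ← Zr_mulVec] at a2
      rw [LS_succ, Matrix.sub_mulVec, ← Matrix.mulVec_mulVec, a1, Matrix.mulVec_neg,
        Matrix.mulVec_mulVec, Matrix.mul_assoc, f1, two, sub_neg_eq_add, add_comm]
      exact a2

/-- shifting a kernel vector -/
lemma shift_ker (q n : ℕ) (s : ℕ → Matrix (Fin q) (Fin q) ℂ)
    (H : (hank q (n+1) s).PosSemidef) (x : ℕ → Fin q → ℂ)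
    (hx : ∀ k ≤ n + 2, ∑ l ∈ Finset.range (n+1), s (k + l) *ᵥ x l = 0) :
    LS q s (n+1) *ᵥ x n = 0 := by
  rw [LS_ker q (n+1) s H]
  refine ⟨fun l => if l = 0 then 0 else x (l-1), by simp, ?_⟩
  intro k hk
  rw [Finset.sum_range_succ']
  simp only [Nat.add_eq_zero_iff, one_ne_zero, and_false, if_false, Nat.add_sub_cancel, if_true,
    Matrix.mulVec_zero, add_zero]
  rw [← hx (k+1) (by omega)]
  apply Finset.sum_congr rfl
  intro l _
  congr 2; omega

lemma inc_a (q n : ℕ) (s : ℕ → Matrix (Fin q) (Fin q) ℂ)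
    (H : (hank q (n+2) s).PosSemidef) (v : Fin q → ℂ) (hv : LS q s n *ᵥ v = 0) :
    LS q s (n+1) *ᵥ v = 0 := by
  have H1 := hank_psd_mono q (n+1) (n+2) (by omega) s H
  have H0 := hank_psd_mono q n (n+2) (by omega) s H
  obtain ⟨x, rfl, hx⟩ := (LS_ker q n s H0 v).1 hv
  have h1 := ker_ext q n s H1 x hx
  apply shift_ker q n s H1
  -- pad by a zero block
  set y : ℕ → Fin q → ℂ := fun l => if l < n + 1 then x l else 0 with hy
  have key : ∀ k, ∑ l ∈ Finset.range (n+1+1), s (k + l) *ᵥ y l =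
      ∑ l ∈ Finset.range (n+1), s (k + l) *ᵥ x l := by
    intro k
    rw [Finset.sum_range_succ]
    simp only [hy, lt_irrefl, if_false, Matrix.mulVec_zero, add_zero]
    apply Finset.sum_congr rfl
    intro l hl
    rw [if_pos (Finset.mem_range.mp hl)]
  have := ker_ext q (n+1) s H y (by intro k hk; rw [key]; exact h1 k hk)
  intro k hk
  rw [← key]; exact this k hk

/-- multiplication by `τ - α` -/
lemma alpha_sum (q n : ℕ) (α : ℝ) (s : ℕ → Matrix (Fin q) (Fin q) ℂ) (x : ℕ → Fin q → ℂ) :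
    ∃ w : ℕ → Fin q → ℂ, w (n+1) = x n ∧
      ∀ k, ∑ l ∈ Finset.range (n+2), s (k + l) *ᵥ w l =
        ∑ l ∈ Finset.range (n+1), sShift α s (k + l) *ᵥ x l := by
  refine ⟨fun l => (if l = 0 then 0 else x (l-1)) +
    (if l < n + 1 then (-(α:ℂ)) • x l else 0), by simp, ?_⟩
  intro k
  simp only [Matrix.mulVec_add, Finset.sum_add_distrib, sShift, Matrix.add_mulVec]
  rw [add_comm]
  congr 1
  · rw [Finset.sum_range_succ]
    simp only [lt_irrefl, if_false, Matrix.mulVec_zero, add_zero]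
    apply Finset.sum_congr rfl
    intro l hl
    rw [if_pos (Finset.mem_range.mp hl), Matrix.mulVec_smul, Matrix.smul_mulVec]
  · rw [Finset.sum_range_succ']
    simp only [Nat.add_eq_zero_iff, one_ne_zero, and_false, if_false, Nat.add_sub_cancel, if_true,
      Matrix.mulVec_zero, add_zero]
    rfl

lemma inc_bc (q n : ℕ) (α : ℝ) (s : ℕ → Matrix (Fin q) (Fin q) ℂ)
    (H : (hank q (n+2) s).PosSemidef) (Hα : (hank q (n+1) (sShift α s)).PosSemidef)
    (v : Fin q → ℂ) (hv : LS q (sShift α s) n *ᵥ v = 0) :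
    LS q (sShift α s) (n+1) *ᵥ v = 0 ∧ LS q s (n+1) *ᵥ v = 0 := by
  have H1 := hank_psd_mono q (n+1) (n+2) (by omega) s H
  have H0 := hank_psd_mono q n (n+1) (by omega) _ Hα
  obtain ⟨x, rfl, hx⟩ := (LS_ker q n _ H0 v).1 hv
  have h1 := ker_ext q n _ Hα x hx
  obtain ⟨w, hw, hws⟩ := alpha_sum q n α s x
  have h2 : ∀ k ≤ n + 1, ∑ l ∈ Finset.range (n+1+1), s (k + l) *ᵥ w l = 0 := by
    intro k hk
    rw [hws, h1 k hk]
  refine ⟨?_, (LS_ker q (n+1) s H1 _).2 ⟨w, hw, h2⟩⟩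
  apply shift_ker q n _ Hα
  intro k hk
  rw [← hws]
  exact ker_ext q (n+1) s H w h2 k hk

lemma G_ker (q n : ℕ) (s : ℕ → Matrix (Fin q) (Fin q) ℂ) (H : (hank q n s).PosSemidef)
    (G : Matrix (Fin (n + 1) × Fin q) (Fin (n + 1) × Fin q) ℂ)
    (hG : IsRGI (hank q n s) G (Dsub q n s)) (x : Fin (n + 1) × Fin q → ℂ) :
    G *ᵥ x = 0 ↔ ∀ j : Fin (n+1), LS q s j.val *ᵥ (fun a => x (j, a)) = 0 := by
  rw [hG.2.2.2 x]
  have hL : (Ldiag q n s)ᴴ = Ldiag q n s := by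
    ext ⟨j, a⟩ ⟨k, b⟩
    simp only [conjTranspose_apply, Ldiag, Matrix.of_apply]
    by_cases h : j = k
    · subst h
      have := LS_herm q j.val s (hank_psd_mono q j.val n (by omega) s H)
      simpa using congrFun (congrFun this a) b
    · rw [if_neg h, if_neg (Ne.symm h), star_zero]
  have e : (∀ y ∈ Dsub q n s, dotProduct (star y) x = 0) ↔ Ldiag q n s *ᵥ x = 0 := by
    constructor
    · intro h
      have := h (Ldiag q n s *ᵥ (Ldiag q n s *ᵥ x)) ⟨_, rfl⟩
      rw [Matrix.star_mulVec, hL, ← Matrix.dotProduct_mulVec] at this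
      exact dotProduct_star_self_eq_zero.1 this
    · rintro h y ⟨z, rfl⟩
      rw [Matrix.mulVecLin_apply, Matrix.star_mulVec, hL, ← Matrix.dotProduct_mulVec, h,
        dotProduct_zero]
  rw [e]
  have c : ∀ (j : Fin (n+1)) a, (Ldiag q n s *ᵥ x) (j, a) =
      (LS q s j.val *ᵥ (fun a => x (j, a))) a := by
    intro j a
    simp only [Matrix.mulVec, dotProduct, Ldiag, Matrix.of_apply, Fintype.sum_prod_type]
    rw [Finset.sum_eq_single j]
    · simp
    · intro b _ hb
      simp [Ne.symm hb]
    · simp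
  constructor
  · intro h j
    ext a
    rw [← c, h]; rfl
  · intro h
    ext ⟨j, a⟩
    rw [c, h]; rfl

lemma bshift_mulVec_zero (q n : ℕ) (x : Fin (n + 1) × Fin q → ℂ) (j : Fin (n+1))
    (hj : j.val = 0) (a : Fin q) : (bshift q n *ᵥ x) (j, a) = 0 := by
  simp [Matrix.mulVec, dotProduct, bshift, hj]

lemma bshift_mulVec_succ (q n : ℕ) (x : Fin (n + 1) × Fin q → ℂ) (j : Fin (n+1)) (i : ℕ)
    (hj : j.val = i + 1) (a : Fin q) :
    (bshift q n *ᵥ x) (j, a) = x (⟨i, by omega⟩, a) := by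
  simp only [Matrix.mulVec, dotProduct, bshift, Matrix.of_apply]
  rw [Finset.sum_eq_single (⟨i, by omega⟩, a)]
  · simp [hj]
  · rintro ⟨k, b⟩ _ hb
    rw [if_neg, zero_mul]
    rintro ⟨h1, h2⟩
    apply hb
    simp only at h1 h2
    ext1
    · ext; simp; omega
    · exact h2.symm
  · simp

lemma shift_maps (q n : ℕ) (s s' : ℕ → Matrix (Fin q) (Fin q) ℂ)
    (h : ∀ i, i + 1 ≤ n → ∀ v, LS q s i *ᵥ v = 0 → LS q s' (i+1) *ᵥ v = 0)
    (x : Fin (n + 1) × Fin q → ℂ)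
    (hx : ∀ j : Fin (n+1), LS q s j.val *ᵥ (fun a => x (j, a)) = 0) :
    ∀ j : Fin (n+1), LS q s' j.val *ᵥ (fun a => (bshift q n *ᵥ x) (j, a)) = 0 := by
  intro j
  rcases Nat.eq_zero_or_eq_succ_pred j.val with h0 | h1
  · simp only [bshift_mulVec_zero q n x j h0]
    exact Matrix.mulVec_zero _
  · simp only [bshift_mulVec_succ q n x j _ h1]
    have := h j.val.pred (by omega) _ (hx ⟨j.val.pred, by omega⟩)
    have e : LS q s' j.val = LS q s' (j.val.pred + 1) := congrArg _ h1
    rw [e]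
    exact this

lemma G_herm {ι : Type*} [Fintype ι] [DecidableEq ι] (H G : Matrix ι ι ℂ)
    (D : Submodule ℂ (ι → ℂ)) (hH : Hᴴ = H) (hG : IsRGI H G D) : Gᴴ = G := by
  obtain ⟨h1, h2, h3, h4⟩ := hG
  have k : ∀ x, Gᴴ *ᵥ x = 0 → G *ᵥ x = 0 := by
    intro x hx
    rw [h4]
    intro y hy
    rw [← h3] at hy
    obtain ⟨z, rfl⟩ := hy
    rw [Matrix.mulVecLin_apply, Matrix.star_mulVec, ← Matrix.dotProduct_mulVec, hx,
      dotProduct_zero]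
  have h2' : Gᴴ * (H * Gᴴ) = Gᴴ := by
    have := congrArg conjTranspose h2
    rwa [conjTranspose_mul, conjTranspose_mul, hH] at this
  have e : G * (1 - H * Gᴴ) = 0 := by
    apply Matrix.ext_of_mulVec_single
    intro i
    rw [← Matrix.mulVec_mulVec, Matrix.zero_mulVec]
    apply k
    rw [Matrix.mulVec_mulVec, Matrix.mul_sub, h2', Matrix.mul_one, sub_self, Matrix.zero_mulVec]
  rw [Matrix.mul_sub, Matrix.mul_one, sub_eq_zero] at e
  rw [e, conjTranspose_mul, conjTranspose_mul, conjTranspose_conjTranspose, hH, Matrix.mul_assoc]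

lemma inv_maps {ι : Type*} [Fintype ι] [DecidableEq ι] (T G : Matrix ι ι ℂ) (ζ : ℂ)
    (h : ∀ x, G *ᵥ x = 0 → G *ᵥ (T *ᵥ x) = 0) (x : ι → ℂ) (hx : G *ᵥ x = 0) :
    G *ᵥ ((1 - ζ • T)⁻¹ *ᵥ x) = 0 := by
  by_cases hu : IsUnit (1 - ζ • T).det
  · let W := LinearMap.ker (Matrix.mulVecLin G)
    have hW : ∀ y ∈ W, Matrix.mulVecLin (1 - ζ • T) y ∈ W := by
      intro y hy
      have hy' : G *ᵥ y = 0 := hy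
      show G *ᵥ ((1 - ζ • T) *ᵥ y) = 0
      rw [Matrix.sub_mulVec, Matrix.one_mulVec, Matrix.smul_mulVec, Matrix.mulVec_sub,
        Matrix.mulVec_smul, h y hy', hy', smul_zero, sub_zero]
    let f := (Matrix.mulVecLin (1 - ζ • T)).restrict hW
    have hf : Function.Injective f := by
      intro a b hab
      have : (1 - ζ • T) *ᵥ a.1 = (1 - ζ • T) *ᵥ b.1 := congrArg Subtype.val hab
      have := congrArg (fun z => (1 - ζ • T)⁻¹ *ᵥ z) this
      simp only [Matrix.mulVec_mulVec, Matrix.nonsing_inv_mul _ hu, Matrix.one_mulVec] at this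
      exact Subtype.ext this
    obtain ⟨w, hw⟩ := LinearMap.injective_iff_surjective.1 hf ⟨x, hx⟩
    have hw' : (1 - ζ • T) *ᵥ w.1 = x := congrArg Subtype.val hw
    rw [← hw', Matrix.mulVec_mulVec _ (1 - ζ • T)⁻¹, Matrix.nonsing_inv_mul _ hu,
      Matrix.one_mulVec]
    exact w.2
  · rw [Matrix.nonsing_inv_apply_not_isUnit _ hu, Matrix.zero_mulVec, Matrix.mulVec_zero]

lemma pow_maps {ι : Type*} [Fintype ι] [DecidableEq ι] (T G : Matrix ι ι ℂ) (k : ℕ)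
    (h : ∀ x, G *ᵥ x = 0 → G *ᵥ (T *ᵥ x) = 0) (x : ι → ℂ) (hx : G *ᵥ x = 0) :
    G *ᵥ (T ^ k *ᵥ x) = 0 := by
  induction k with
  | zero => simpa using hx
  | succ k ih =>
    rw [pow_succ', ← Matrix.mulVec_mulVec]
    exact h _ ih

lemma annih {ι : Type*} [Fintype ι] [DecidableEq ι] (T G H' G' : Matrix ι ι ℂ) (ζ : ℂ) (k : ℕ)
    (h : ∀ x, G *ᵥ x = 0 → G *ᵥ (T *ᵥ x) = 0)
    (hk : ∀ x, G' *ᵥ x = 0 → G *ᵥ (T ^ k *ᵥ x) = 0)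
    (hG' : G' * H' * G' = G') (gh : Gᴴ = G) (gh' : G'ᴴ = G') (hh' : H'ᴴ = H') :
    G * (1 - ζ • T)⁻¹ * T ^ k * (1 - H' * G') = 0 ∧
    (1 - G' * H') * Tᴴ ^ k * ((1 - ζ • T)⁻¹)ᴴ * G = 0 := by
  have e : G * (1 - ζ • T)⁻¹ * T ^ k * (1 - H' * G') = 0 := by
    apply Matrix.ext_of_mulVec_single
    intro i
    rw [← Matrix.mulVec_mulVec, ← Matrix.mulVec_mulVec, ← Matrix.mulVec_mulVec, Matrix.zero_mulVec]
    -- T ^ k maps the kernel of G' to the kernel of G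
    apply inv_maps T G ζ h
    apply hk
    rw [Matrix.mulVec_mulVec, Matrix.mul_sub, ← Matrix.mul_assoc, hG', Matrix.mul_one, sub_self,
      Matrix.zero_mulVec]
  refine ⟨e, ?_⟩
  have := congrArg conjTranspose e
  simp only [conjTranspose_mul, conjTranspose_sub, conjTranspose_one, conjTranspose_zero, gh, gh',
    hh', conjTranspose_pow] at this
  simpa only [Matrix.mul_assoc] using this

lemma hank_congr (q n : ℕ) (s t : ℕ → Matrix (Fin q) (Fin q) ℂ) (h : ∀ j ≤ 2 * n, t j = s j) :
    hank q n s = hank q n t := by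
  ext ⟨j, a⟩ ⟨k, b⟩
  simp only [hank, Matrix.of_apply]
  rw [h _ (by omega)]

lemma LS_congr (q n : ℕ) (s t : ℕ → Matrix (Fin q) (Fin q) ℂ) (h : ∀ j ≤ 2 * n, t j = s j) :
    LS q s n = LS q t n := by
  cases n with
  | zero => exact (h 0 (by omega)).symm
  | succ n =>
    have hZ : Zr q n s = Zr q n t := by
      ext a ⟨k, b⟩
      simp only [Zr, Matrix.of_apply]
      rw [h _ (by omega)]
    have hY : Yc q n s = Yc q n t := by
      ext ⟨k, b⟩ a
      simp only [Yc, Matrix.of_apply]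
      rw [h _ (by omega)]
    rw [LS_succ, LS_succ, hZ, hY, hank_congr q n s t (fun j hj => h j (by omega)),
      h _ le_rfl]

lemma Dsub_congr (q n : ℕ) (s t : ℕ → Matrix (Fin q) (Fin q) ℂ) (h : ∀ j ≤ 2 * n, t j = s j) :
    Dsub q n s = Dsub q n t := by
  have : Ldiag q n s = Ldiag q n t := by
    ext ⟨j, a⟩ ⟨k, b⟩
    simp only [Ldiag, Matrix.of_apply]
    rw [LS_congr q j.val s t (fun i hi => h i (by omega))]
  rw [Dsub, Dsub, this]

/-- Lemma (ML8-1): annihilation identities for the generalized inverses `H_n^⊐` and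
`H_{α▷n}^⊐` against powers of the block shift and the resolvent `R_T(ζ)`. -/
theorem generalized_inverse_shift_annihilation
    (q : ℕ) (hq : 1 ≤ q) (α : ℝ) (n : ℕ) (s : ℕ → Matrix (Fin q) (Fin q) ℂ)
    (hK : ∃ t : ℕ → Matrix (Fin q) (Fin q) ℂ,
      (∀ j ≤ 2 * n + 1, t j = s j) ∧
        (hank q (n + 1) t).PosSemidef ∧ (hank q n (sShift α t)).PosSemidef)
    (G Gα : Matrix (Fin (n + 1) × Fin q) (Fin (n + 1) × Fin q) ℂ)
    (hG : IsRGI (hank q n s) G (Dsub q n s))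
    (hGα : IsRGI (hank q n (sShift α s)) Gα (Dsub q n (sShift α s))) :
    (∀ (ζ : ℂ) (k : ℕ),
      G * RT q n ζ * bshift q n ^ k * (1 - hank q n s * G) = 0 ∧
      (1 - G * hank q n s) * ((bshift q n)ᴴ) ^ k * (RT q n ζ)ᴴ * G = 0 ∧
      Gα * RT q n ζ * bshift q n ^ k * (1 - hank q n (sShift α s) * Gα) = 0 ∧
      (1 - Gα * hank q n (sShift α s)) * ((bshift q n)ᴴ) ^ k * (RT q n ζ)ᴴ * Gα = 0) ∧
    (∀ (ζ : ℂ) (k : ℕ), 1 ≤ k →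
      G * RT q n ζ * bshift q n ^ k * (1 - hank q n (sShift α s) * Gα) = 0 ∧
      (1 - Gα * hank q n (sShift α s)) * ((bshift q n)ᴴ) ^ k * (RT q n ζ)ᴴ * G = 0) := by
  obtain ⟨t, ht, P, Pα⟩ := hK
  have c1 := hank_congr q n s t (fun j hj => ht j (by omega))
  have c2 := Dsub_congr q n s t (fun j hj => ht j (by omega))
  have hs : ∀ j ≤ 2 * n, sShift α t j = sShift α s j := by
    intro j hj
    simp only [sShift]
    rw [ht j (by omega), ht (j+1) (by omega)]
  have c3 := hank_congr q n (sShift α s) (sShift α t) hs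
  have c4 := Dsub_congr q n (sShift α s) (sShift α t) hs
  rw [c1, c2] at hG
  rw [c3, c4] at hGα
  rw [c1, c3]
  have P0 := hank_psd_mono q n (n+1) (by omega) t P
  have gh := G_herm _ _ _ P0.1 hG
  have ghα := G_herm _ _ _ Pα.1 hGα
  have kG := G_ker q n t P0 G hG
  have kGα := G_ker q n _ Pα Gα hGα
  have m1 : ∀ x, G *ᵥ x = 0 → G *ᵥ (bshift q n *ᵥ x) = 0 := by
    intro x hx
    rw [kG] at hx ⊢
    refine shift_maps q n _ _ ?_ x hx
    intro i hi v hv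
    exact inc_a q i t (hank_psd_mono q (i+2) (n+1) (by omega) t P) v hv
  have m23 : ∀ i, i + 1 ≤ n → ∀ v, LS q (sShift α t) i *ᵥ v = 0 →
      LS q (sShift α t) (i+1) *ᵥ v = 0 ∧ LS q t (i+1) *ᵥ v = 0 := by
    intro i hi v hv
    exact inc_bc q i α t (hank_psd_mono q (i+2) (n+1) (by omega) t P)
      (hank_psd_mono q (i+1) n hi _ Pα) v hv
  have m2 : ∀ x, Gα *ᵥ x = 0 → Gα *ᵥ (bshift q n *ᵥ x) = 0 := by
    intro x hx
    rw [kGα] at hx ⊢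
    exact shift_maps q n _ _ (fun i hi v hv => (m23 i hi v hv).1) x hx
  have m3 : ∀ x, Gα *ᵥ x = 0 → G *ᵥ (bshift q n *ᵥ x) = 0 := by
    intro x hx
    rw [kGα] at hx
    rw [kG]
    exact shift_maps q n _ _ (fun i hi v hv => (m23 i hi v hv).2) x hx
  refine ⟨fun ζ k => ?_, fun ζ k hk => ?_⟩
  · have a := annih (bshift q n) G (hank q n t) G ζ k m1 (pow_maps _ _ k m1) hG.2.1 gh gh P0.1
    have b := annih (bshift q n) Gα (hank q n (sShift α t)) Gα ζ k m2 (pow_maps _ _ k m2)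
      hGα.2.1 ghα ghα Pα.1
    exact ⟨a.1, a.2, b.1, b.2⟩
  · refine annih (bshift q n) G (hank q n (sShift α t)) Gα ζ k m1 ?_ hGα.2.1 gh ghα Pα.1
    intro x hx
    obtain ⟨k, rfl⟩ : ∃ k', k = k' + 1 := ⟨k - 1, by omega⟩
    rw [pow_succ, ← Matrix.mulVec_mulVec]
    exact pow_maps _ _ k m1 _ (m3 x hx)
end
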